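/- The downward refinement operator ρ_⪯ defined by the rewrite rules R0PO, R1PO, R2PO, R3PO, R4PO, and R5PO is locally finite and complete for the quasi-ordered set (G, ⊑⪯), where ⊑⪯ is subsumption relative to the partial order ⪯ on labels. -/

import Mathlib

/-- A directed labeled graph (DLG) over a label type `L`, with vertices drawn from `ℕ`:
a finite vertex set `V`, a finite edge set `E ⊆ V × V`, and labeling functions for
vertices and edges. -/
structure DLG (L : Type) where
  V : Finset ℕ
  E : Finset (ℕ × ℕ)
  lv : ℕ → L
  le : ℕ × ℕ → L
  edge_mem : ∀ e ∈ E, e.1 ∈ V ∧ e.2 ∈ V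

namespace DLG

variable {L : Type}

/-- Undirected adjacency: there is an edge between `v` and `w` in either direction. -/
def adj (g : DLG L) (v w : ℕ) : Prop :=
  (v, w) ∈ g.E ∨ (w, v) ∈ g.E

/-- A DLG is connected when any two of its vertices are joined by an undirected path. -/
def Connected (g : DLG L) : Prop :=
  ∀ v ∈ g.V, ∀ w ∈ g.V, Relation.ReflTransGen g.adj v w

/-- A canonical fresh vertex not belonging to `g.V`. -/
def fresh (g : DLG L) : ℕ := g.V.sup id + 1

/-- The graph obtained by deleting the edge `e`. -/
def removeEdge (g : DLG L) (e : ℕ × ℕ) : DLG L where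
  V := g.V
  E := g.E.erase e
  lv := g.lv
  le := g.le
  edge_mem := fun e' he' => g.edge_mem e' (Finset.mem_of_mem_erase he')

/-- An edge `e ∈ E` is a bridge of `g` when removing it leaves a disconnected graph. -/
def IsBridge (g : DLG L) (e : ℕ × ℕ) : Prop :=
  e ∈ g.E ∧ ¬ (g.removeEdge e).Connected

/-- The set of edges of `g` incident to the vertex `v`. -/
def incident (g : DLG L) (v : ℕ) : Finset (ℕ × ℕ) :=
  g.E.filter fun e => e.1 = v ∨ e.2 = v

/-! ### Subsumption relations -/

/-- `m` witnesses that `g₁` subsumes `g₂` (regular subsumption). -/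
def SubsWith (g₁ g₂ : DLG L) (m : ℕ → ℕ) : Prop :=
  (∀ v ∈ g₁.V, m v ∈ g₂.V) ∧
  (∀ e ∈ g₁.E, (m e.1, m e.2) ∈ g₂.E) ∧
  (∀ v ∈ g₁.V, g₁.lv v = g₂.lv (m v)) ∧
  (∀ e ∈ g₁.E, g₁.le e = g₂.le (m e.1, m e.2))

/-- Regular subsumption `g₁ ⊑ g₂`. -/
def Subs (g₁ g₂ : DLG L) : Prop := ∃ m, SubsWith g₁ g₂ m

/-- The object-identity constraint on a vertex mapping: injectivity on `g₁.V`. -/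
def OI (g₁ : DLG L) (m : ℕ → ℕ) : Prop :=
  ∀ v₁ ∈ g₁.V, ∀ v₂ ∈ g₁.V, v₁ ≠ v₂ → m v₁ ≠ m v₂

/-- Regular subsumption under object identity. -/
def SubsOI (g₁ g₂ : DLG L) : Prop := ∃ m, SubsWith g₁ g₂ m ∧ OI g₁ m

/-- `m` and `me` witness that `g₁` trans-subsumes `g₂`: each edge of `g₁` is mapped to a
sequence of consecutive edges of `g₂` (given by the list of vertices `me e`), all carrying
the label of the original edge. -/
def TransSubsWith (g₁ g₂ : DLG L) (m : ℕ → ℕ) (me : ℕ × ℕ → List ℕ) : Prop :=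
  (∀ v ∈ g₁.V, m v ∈ g₂.V) ∧
  (∀ v ∈ g₁.V, g₁.lv v = g₂.lv (m v)) ∧
  (∀ e ∈ g₁.E,
    2 ≤ (me e).length ∧
    (me e).head? = some (m e.1) ∧
    (me e).getLast? = some (m e.2) ∧
    (me e).Chain' fun a b => (a, b) ∈ g₂.E ∧ g₂.le (a, b) = g₁.le e)

/-- Trans-subsumption `g₁ ⊑→ g₂`. -/
def TransSubs (g₁ g₂ : DLG L) : Prop := ∃ m me, TransSubsWith g₁ g₂ m me

/-- The object-identity constraint for trans-subsumption: `m` is injective on `g₁.V`, and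
no vertex of `g₁` other than the endpoints of an edge `e` of `g₁` is mapped into the
path `me e`. -/
def TransOI (g₁ : DLG L) (m : ℕ → ℕ) (me : ℕ × ℕ → List ℕ) : Prop :=
  OI g₁ m ∧ ∀ v ∈ g₁.V, ∀ e ∈ g₁.E, v ≠ e.1 → v ≠ e.2 → m v ∉ me e

/-- Trans-subsumption under object identity. -/
def TransSubsOI (g₁ g₂ : DLG L) : Prop :=
  ∃ m me, TransSubsWith g₁ g₂ m me ∧ TransOI g₁ m me

section OrderLabeled

variable [PartialOrder L]

/-- `m` witnesses subsumption relative to the partial order `≤` (i.e. `⪯`) on labels. -/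
def SubsPOWith (g₁ g₂ : DLG L) (m : ℕ → ℕ) : Prop :=
  (∀ v ∈ g₁.V, m v ∈ g₂.V) ∧
  (∀ e ∈ g₁.E, (m e.1, m e.2) ∈ g₂.E) ∧
  (∀ v ∈ g₁.V, g₁.lv v ≤ g₂.lv (m v)) ∧
  (∀ e ∈ g₁.E, g₁.le e ≤ g₂.le (m e.1, m e.2))

/-- Subsumption relative to `⪯`: `g₁ ⊑⪯ g₂`. -/
def SubsPO (g₁ g₂ : DLG L) : Prop := ∃ m, SubsPOWith g₁ g₂ m

/-- Subsumption relative to `⪯` under object identity. -/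
def SubsPOOI (g₁ g₂ : DLG L) : Prop := ∃ m, SubsPOWith g₁ g₂ m ∧ OI g₁ m

/-- `m` and `me` witness trans-subsumption relative to `⪯`. -/
def TransSubsPOWith (g₁ g₂ : DLG L) (m : ℕ → ℕ) (me : ℕ × ℕ → List ℕ) : Prop :=
  (∀ v ∈ g₁.V, m v ∈ g₂.V) ∧
  (∀ v ∈ g₁.V, g₁.lv v ≤ g₂.lv (m v)) ∧
  (∀ e ∈ g₁.E,
    2 ≤ (me e).length ∧
    (me e).head? = some (m e.1) ∧
    (me e).getLast? = some (m e.2) ∧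
    (me e).Chain' fun a b => (a, b) ∈ g₂.E ∧ g₁.le e ≤ g₂.le (a, b))

/-- Trans-subsumption relative to `⪯`: `g₁ ⊑→⪯ g₂`. -/
def TransSubsPO (g₁ g₂ : DLG L) : Prop := ∃ m me, TransSubsPOWith g₁ g₂ m me

/-- Trans-subsumption relative to `⪯` under object identity. -/
def TransSubsPOOI (g₁ g₂ : DLG L) : Prop :=
  ∃ m me, TransSubsPOWith g₁ g₂ m me ∧ TransOI g₁ m me

end OrderLabeled

/-! ### Refinement operators for flat-labeled DLGs -/

/-- The downward refinement operator `ρ_f`, given by rewrite rules R0, R1, R2, R3. -/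
def rho_f (g : DLG L) : Set (DLG L) :=
  {g' |
    -- R0: add a single vertex (labeled `a`) to the empty graph
    (g.V = ∅ ∧ g.E = ∅ ∧ ∃ a : L,
      g'.V = {g.fresh} ∧ g'.E = ∅ ∧
      g'.lv = Function.update g.lv g.fresh a ∧ g'.le = g.le) ∨
    -- R1: add a new vertex `v*` labeled `a` with outgoing edge `(v*, v₁)` labeled `b`
    (∃ v₁ ∈ g.V, ∃ a b : L,
      g'.V = insert g.fresh g.V ∧
      g'.E = insert (g.fresh, v₁) g.E ∧
      g'.lv = Function.update g.lv g.fresh a ∧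
      g'.le = Function.update g.le (g.fresh, v₁) b) ∨
    -- R2: add a new vertex `v*` labeled `a` with incoming edge `(v₁, v*)` labeled `b`
    (∃ v₁ ∈ g.V, ∃ a b : L,
      g'.V = insert g.fresh g.V ∧
      g'.E = insert (v₁, g.fresh) g.E ∧
      g'.lv = Function.update g.lv g.fresh a ∧
      g'.le = Function.update g.le (v₁, g.fresh) b) ∨
    -- R3: add an edge `(v₁, v₂)` labeled `a`
    (∃ v₁ ∈ g.V, ∃ v₂ ∈ g.V, (v₁, v₂) ∉ g.E ∧ ∃ a : L,
      g'.V = g.V ∧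
      g'.E = insert (v₁, v₂) g.E ∧
      g'.lv = g.lv ∧
      g'.le = Function.update g.le (v₁, v₂) a)}

/-- The downward refinement operator `ρ_tf`, given by rules R0–R3 together with the
split-edge rule R4. -/
def rho_tf (g : DLG L) : Set (DLG L) :=
  rho_f g ∪
  -- R4: split an edge `e` by a new vertex labeled `a`; both halves keep the label of `e`
  {g' | ∃ e ∈ g.E, ∃ a : L,
    g'.V = insert g.fresh g.V ∧
    g'.E = insert (e.1, g.fresh) (insert (g.fresh, e.2) (g.E.erase e)) ∧
    g'.lv = Function.update g.lv g.fresh a ∧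
    g'.le = Function.update (Function.update g.le (e.1, g.fresh) (g.le e))
      (g.fresh, e.2) (g.le e)}

/-- The upward refinement operator `γ_f`, given by rewrite rules UR0 and UR1. -/
def gamma_f (g : DLG L) : Set (DLG L) :=
  {g' |
    -- UR0: remove a non-bridge edge
    (∃ e ∈ g.E, ¬ g.IsBridge e ∧ g' = g.removeEdge e) ∨
    -- UR1: remove a vertex incident to at most one edge, with its incident edges
    (∃ v ∈ g.V, (g.incident v).card ≤ 1 ∧
      g'.V = g.V.erase v ∧ g'.E = g.E \ g.incident v ∧
      g'.lv = g.lv ∧ g'.le = g.le)}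

/-- The upward refinement operator `γ_tf`, given by rules UR0, UR1 together with the
shorten-edge rule UR2. -/
def gamma_tf (g : DLG L) : Set (DLG L) :=
  gamma_f g ∪
  -- UR2: replace edges `(v₁,v₂)`, `(v₂,v₃)` with the same label, where `v₂` has no other
  -- incident edges, by a single edge `(v₁,v₃)` with that label, deleting `v₂`
  {g' | ∃ v₁ v₂ v₃ : ℕ, (v₁, v₂) ∈ g.E ∧ (v₂, v₃) ∈ g.E ∧
    g.le (v₁, v₂) = g.le (v₂, v₃) ∧
    (∀ e ∈ g.E, e ≠ (v₁, v₂) → e.2 ≠ v₂) ∧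
    (∀ e ∈ g.E, e ≠ (v₂, v₃) → e.1 ≠ v₂) ∧
    g'.V = g.V.erase v₂ ∧
    g'.E = insert (v₁, v₃) ((g.E.erase (v₁, v₂)).erase (v₂, v₃)) ∧
    g'.lv = g.lv ∧
    g'.le = Function.update g.le (v₁, v₃) (g.le (v₁, v₂))}

/-! ### Refinement operators for order-labeled DLGs
Here the label set carries a partial order `≤` (standing for `⪯`) and `T` denotes the
distinguished most general label `⊤` (with `T ≤ a` for every label `a`). -/

section OrderLabeledOps

variable [PartialOrder L]

/-- The downward refinement operator `ρ_⪯`, given by rules R0PO–R5PO. -/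
def rhoPO (T : L) (g : DLG L) : Set (DLG L) :=
  {g' |
    -- R0PO: add a single vertex labeled ⊤ to the empty graph
    (g.V = ∅ ∧ g.E = ∅ ∧
      g'.V = {g.fresh} ∧ g'.E = ∅ ∧
      g'.lv = Function.update g.lv g.fresh T ∧ g'.le = g.le) ∨
    -- R1PO: add a new vertex `v*` labeled ⊤ and the edge `(v₁, v*)` labeled ⊤
    (∃ v₁ ∈ g.V,
      g'.V = insert g.fresh g.V ∧
      g'.E = insert (v₁, g.fresh) g.E ∧
      g'.lv = Function.update g.lv g.fresh T ∧
      g'.le = Function.update g.le (v₁, g.fresh) T) ∨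
    -- R2PO: add a new vertex `v*` labeled ⊤ and the edge `(v*, v₁)` labeled ⊤
    (∃ v₁ ∈ g.V,
      g'.V = insert g.fresh g.V ∧
      g'.E = insert (g.fresh, v₁) g.E ∧
      g'.lv = Function.update g.lv g.fresh T ∧
      g'.le = Function.update g.le (g.fresh, v₁) T) ∨
    -- R3PO: add an edge `(v₁, v₂)` labeled ⊤
    (∃ v₁ ∈ g.V, ∃ v₂ ∈ g.V, (v₁, v₂) ∉ g.E ∧
      g'.V = g.V ∧ g'.E = insert (v₁, v₂) g.E ∧
      g'.lv = g.lv ∧ g'.le = Function.update g.le (v₁, v₂) T) ∨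
    -- R4PO: refine a vertex label one step downwards in `⪯`
    (∃ v₁ ∈ g.V, ∃ b : L, g.lv v₁ < b ∧ (¬ ∃ c : L, g.lv v₁ < c ∧ c < b) ∧
      g'.V = g.V ∧ g'.E = g.E ∧
      g'.lv = Function.update g.lv v₁ b ∧ g'.le = g.le) ∨
    -- R5PO: refine an edge label one step downwards in `⪯`
    (∃ e ∈ g.E, ∃ b : L, g.le e < b ∧ (¬ ∃ c : L, g.le e < c ∧ c < b) ∧
      g'.V = g.V ∧ g'.E = g.E ∧
      g'.lv = g.lv ∧ g'.le = Function.update g.le e b)}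

/-- The downward refinement operator `ρ_t⪯`, given by rules R0PO–R5PO together with the
split-edge rule R6PO. -/
def rhoTPO (T : L) (g : DLG L) : Set (DLG L) :=
  rhoPO T g ∪
  -- R6PO: split an edge `e` by a new vertex labeled ⊤; both halves keep the label of `e`
  {g' | ∃ e ∈ g.E,
    g'.V = insert g.fresh g.V ∧
    g'.E = insert (e.1, g.fresh) (insert (g.fresh, e.2) (g.E.erase e)) ∧
    g'.lv = Function.update g.lv g.fresh T ∧
    g'.le = Function.update (Function.update g.le (e.1, g.fresh) (g.le e))
      (g.fresh, e.2) (g.le e)}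

/-- The upward refinement operator `γ_⪯`, given by rules UR0PO–UR3PO. -/
def gammaPO (T : L) (g : DLG L) : Set (DLG L) :=
  {g' |
    -- UR0PO: generalize a vertex label one step upwards in `⪯`
    (∃ v₁ ∈ g.V, ∃ b : L, b < g.lv v₁ ∧ (¬ ∃ c : L, b < c ∧ c < g.lv v₁) ∧
      g'.V = g.V ∧ g'.E = g.E ∧
      g'.lv = Function.update g.lv v₁ b ∧ g'.le = g.le) ∨
    -- UR1PO: generalize an edge label one step upwards in `⪯`
    (∃ e ∈ g.E, ∃ b : L, b < g.le e ∧ (¬ ∃ c : L, b < c ∧ c < g.le e) ∧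
      g'.V = g.V ∧ g'.E = g.E ∧
      g'.lv = g.lv ∧ g'.le = Function.update g.le e b) ∨
    -- UR2PO: remove a non-bridge edge labeled ⊤
    (∃ e ∈ g.E, g.le e = T ∧ ¬ g.IsBridge e ∧ g' = g.removeEdge e) ∨
    -- UR3PO: remove a vertex labeled ⊤ incident to at most one edge, all incident
    -- edges being labeled ⊤, together with those edges
    (∃ v ∈ g.V, g.lv v = T ∧ (g.incident v).card ≤ 1 ∧
      (∀ e ∈ g.incident v, g.le e = T) ∧
      g'.V = g.V.erase v ∧ g'.E = g.E \ g.incident v ∧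
      g'.lv = g.lv ∧ g'.le = g.le)}

/-- The upward refinement operator `γ_t⪯`, given by rules UR0PO–UR3PO together with the
shorten-edge rule UR4PO. -/
def gammaTPO (T : L) (g : DLG L) : Set (DLG L) :=
  gammaPO T g ∪
  -- UR4PO: as UR2, additionally requiring the removed middle vertex to be labeled ⊤
  {g' | ∃ v₁ v₂ v₃ : ℕ, (v₁, v₂) ∈ g.E ∧ (v₂, v₃) ∈ g.E ∧
    g.lv v₂ = T ∧
    g.le (v₁, v₂) = g.le (v₂, v₃) ∧
    (∀ e ∈ g.E, e ≠ (v₁, v₂) → e.2 ≠ v₂) ∧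
    (∀ e ∈ g.E, e ≠ (v₂, v₃) → e.1 ≠ v₂) ∧
    g'.V = g.V.erase v₂ ∧
    g'.E = insert (v₁, v₃) ((g.E.erase (v₁, v₂)).erase (v₂, v₃)) ∧
    g'.lv = g.lv ∧
    g'.le = Function.update g.le (v₁, v₃) (g.le (v₁, v₂))}

end OrderLabeledOps

/-- The cover of `g₁` over `g₂` via a mapping `m`: the subgraph of `g₂` consisting of the
vertices and edges referred to by `m`. -/
def cover (g₁ g₂ : DLG L) (m : ℕ → ℕ) : DLG L where
  V := g₁.V.image m
  E := g₁.E.image fun e => (m e.1, m e.2)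
  lv := g₂.lv
  le := g₂.le
  edge_mem := by
    intro e he
    simp only [Finset.mem_image] at he
    obtain ⟨e', he', rfl⟩ := he
    exact ⟨Finset.mem_image_of_mem m (g₁.edge_mem e' he').1,
      Finset.mem_image_of_mem m (g₁.edge_mem e' he').2⟩

end DLG

namespace DLG

theorem fresh_notMem {L : Type} (g : DLG L) : g.fresh ∉ g.V := fun h =>
  Nat.not_succ_le_self _ (Finset.le_sup (f := id) h)

theorem ext_of_data {L : Type} {g h : DLG L} (hV : g.V = h.V) (hE : g.E = h.E)
    (hlv : g.lv = h.lv) (hle : g.le = h.le) : g = h := by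
  cases g; cases h; simp_all

/-- A set of vertices containing the start but not the end of a path is left by some edge. -/
theorem exists_adj_of_reflTransGen {L : Type} {g : DLG L} {s : Set ℕ} {a b : ℕ}
    (h : Relation.ReflTransGen g.adj a b) (ha : a ∈ s) (hb : b ∉ s) :
    ∃ x ∈ s, ∃ y ∉ s, g.adj x y := by
  induction h with
  | refl => exact absurd ha hb
  | @tail c d _ hcd ih =>
    by_cases hc : c ∈ s
    exacts [⟨c, hc, d, hb, hcd⟩, ih hc]

section Refinement

variable {L : Type} [PartialOrder L]

/-- A graph has finitely many `ρ_⪯`-refinements, since they are determined by a choice of rule,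
of vertices or edges, and of a label. -/
theorem rhoPO_finite [Finite L] (T : L) (g : DLG L) : (rhoPO T g).Finite := by
  have inj : Function.Injective fun h : DLG L => (h.V, h.E, h.lv, h.le) := fun h h' e => by
    simp only [Prod.mk.injEq] at e
    exact ext_of_data e.1 e.2.1 e.2.2.1 e.2.2.2
  refine Set.Finite.of_finite_image ?_ inj.injOn
  let A : Set (Finset ℕ) := {{g.fresh}, insert g.fresh g.V, g.V}
  let B : Set (Finset (ℕ × ℕ)) := {∅, g.E} ∪ (fun e => insert e g.E) ''
    (((insert g.fresh g.V) ×ˢ (insert g.fresh g.V) : Finset (ℕ × ℕ)) : Set (ℕ × ℕ))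
  let C : Set (ℕ → L) := {g.lv} ∪ (fun p : ℕ × L => Function.update g.lv p.1 p.2) ''
    (((insert g.fresh g.V : Finset ℕ) : Set ℕ) ×ˢ Set.univ)
  let D : Set (ℕ × ℕ → L) := {g.le} ∪ (fun p : (ℕ × ℕ) × L => Function.update g.le p.1 p.2) ''
    ((((insert g.fresh g.V) ×ˢ (insert g.fresh g.V) : Finset (ℕ × ℕ)) : Set (ℕ × ℕ)) ×ˢ Set.univ)
  have hA : A.Finite := by simp [A]
  have hB : B.Finite := (by simp : ({∅, g.E} : Set (Finset (ℕ × ℕ))).Finite).union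
    ((Finset.finite_toSet _).image _)
  have hC : C.Finite := (Set.finite_singleton _).union
    (((Finset.finite_toSet _).prod Set.finite_univ).image _)
  have hD : D.Finite := (Set.finite_singleton _).union
    (((Finset.finite_toSet _).prod Set.finite_univ).image _)
  refine (hA.prod (hB.prod (hC.prod hD))).subset ?_
  have memB {v w} (hv : v ∈ insert g.fresh g.V) (hw : w ∈ insert g.fresh g.V) :
      insert (v, w) g.E ∈ B := Or.inr ⟨(v, w), Finset.mem_coe.2 (Finset.mk_mem_product hv hw), rfl⟩
  have memC {v} (b : L) (hv : v ∈ insert g.fresh g.V) : Function.update g.lv v b ∈ C :=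
    Or.inr ⟨(v, b), by simpa using hv, rfl⟩
  have memD {v w} (b : L) (hv : v ∈ insert g.fresh g.V) (hw : w ∈ insert g.fresh g.V) :
      Function.update g.le (v, w) b ∈ D := Or.inr
      ⟨((v, w), b), ⟨Finset.mem_coe.2 (Finset.mk_mem_product hv hw), trivial⟩, rfl⟩
  have hf := Finset.mem_insert_self g.fresh g.V
  have hs {v} (hv : v ∈ g.V) := Finset.mem_insert_of_mem (b := g.fresh) hv
  rintro _ ⟨h, hh, rfl⟩
  simp only [Set.mem_prod]
  rcases hh with ⟨-, -, hV, hE, hlv, hle⟩ | ⟨v, hv, hV, hE, hlv, hle⟩ |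
    ⟨v, hv, hV, hE, hlv, hle⟩ | ⟨v, hv, w, hw, -, hV, hE, hlv, hle⟩ |
    ⟨v, hv, b, -, -, hV, hE, hlv, hle⟩ | ⟨e, he, b, -, -, hV, hE, hlv, hle⟩ <;>
    rw [hV, hE, hlv, hle]
  · exact ⟨by simp [A], by simp [B], memC _ hf, by simp [D]⟩
  · exact ⟨by simp [A], memB (hs hv) hf, memC _ hf, memD _ (hs hv) hf⟩
  · exact ⟨by simp [A], memB hf (hs hv), memC _ hf, memD _ hf (hs hv)⟩
  · exact ⟨by simp [A], memB (hs hv) (hs hw), by simp [C], memD _ (hs hv) (hs hw)⟩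
  · exact ⟨by simp [A], by simp [B], memC _ (hs hv), by simp [D]⟩
  · exact ⟨by simp [A], by simp [B], by simp [C],
      memD _ (hs (g.edge_mem e he).1) (hs (g.edge_mem e he).2)⟩

/-- `Reach T g h` holds when `h` is obtained from `g` by finitely many `ρ_⪯`-refinements. -/
abbrev Reach (T : L) (g h : DLG L) : Prop :=
  Relation.ReflTransGen (fun x y => y ∈ rhoPO T x) g h

/-- A vertex label can be refined to any label below it in the refinement order. -/
theorem reach_update_lv [Finite L] (T : L) (g : DLG L) {v : ℕ} (hv : v ∈ g.V) {b : L}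
    (hb : g.lv v ≤ b) : Reach T g { g with lv := Function.update g.lv v b } := by
  classical
  have := Fintype.ofFinite L
  let := Fintype.toLocallyFiniteOrder (α := L)
  induction le_iff_reflTransGen_covBy.1 hb with
  | refl => simpa using Relation.ReflTransGen.refl
  | @tail c d hc hcd ih =>
    refine (ih (le_iff_reflTransGen_covBy.2 hc)).tail ?_
    refine Or.inr <| Or.inr <| Or.inr <| Or.inr <| Or.inl
      ⟨v, hv, d, by simpa using hcd.1, ?_, rfl, rfl, by simp, rfl⟩
    rintro ⟨x, hx, hxd⟩
    exact hcd.2 (by simpa using hx) hxd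

/-- An edge label can be refined to any label below it in the refinement order. -/
theorem reach_update_le [Finite L] (T : L) (g : DLG L) {e : ℕ × ℕ} (he : e ∈ g.E) {b : L}
    (hb : g.le e ≤ b) : Reach T g { g with le := Function.update g.le e b } := by
  classical
  have := Fintype.ofFinite L
  let := Fintype.toLocallyFiniteOrder (α := L)
  induction le_iff_reflTransGen_covBy.1 hb with
  | refl => simpa using Relation.ReflTransGen.refl
  | @tail c d hc hcd ih =>
    refine (ih (le_iff_reflTransGen_covBy.2 hc)).tail ?_
    refine Or.inr <| Or.inr <| Or.inr <| Or.inr <| Or.inr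
      ⟨e, he, d, by simpa using hcd.1, ?_, rfl, rfl, rfl, by simp⟩
    rintro ⟨x, hx, hxd⟩
    exact hcd.2 (by simpa using hx) hxd

theorem exists_reach_lv_eq [Finite L] (T : L) {g k : DLG L} {m : ℕ → ℕ} (hm : SubsPOWith g k m)
    (S : Finset ℕ) (hS : S ⊆ g.V) :
    ∃ h, Reach T g h ∧ h.V = g.V ∧ h.E = g.E ∧ SubsPOWith h k m ∧
      ∀ v ∈ S, h.lv v = k.lv (m v) := by
  induction S using Finset.induction_on with
  | empty => exact ⟨g, .refl, rfl, rfl, hm, by simp⟩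
  | insert v S _ ih =>
    obtain ⟨hv, hS⟩ := Finset.insert_subset_iff.1 hS
    obtain ⟨h, hr, hV, hE, hk, hl⟩ := ih hS
    rw [← hV] at hv
    refine ⟨_, hr.trans (reach_update_lv T h hv (hk.2.2.1 v hv)), hV, hE,
      ⟨hk.1, hk.2.1, fun w hw => ?_, hk.2.2.2⟩, fun w hw => ?_⟩
    · by_cases hwv : w = v
      · simp [hwv]
      · simpa [hwv] using hk.2.2.1 w hw
    · by_cases hwv : w = v
      · simp [hwv]
      · simpa [hwv] using hl w (by simpa [hwv] using hw)

theorem exists_reach_le_eq [Finite L] (T : L) {g k : DLG L} {m : ℕ → ℕ} (hm : SubsPOWith g k m)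
    (S : Finset (ℕ × ℕ)) (hS : S ⊆ g.E) :
    ∃ h, Reach T g h ∧ h.V = g.V ∧ h.E = g.E ∧ h.lv = g.lv ∧ SubsPOWith h k m ∧
      ∀ e ∈ S, h.le e = k.le (m e.1, m e.2) := by
  induction S using Finset.induction_on with
  | empty => exact ⟨g, .refl, rfl, rfl, rfl, hm, by simp⟩
  | insert e S _ ih =>
    obtain ⟨he, hS⟩ := Finset.insert_subset_iff.1 hS
    obtain ⟨h, hr, hV, hE, hlv, hk, hl⟩ := ih hS
    rw [← hE] at he
    refine ⟨_, hr.trans (reach_update_le T h he (hk.2.2.2 e he)), hV, hE, hlv,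
      ⟨hk.1, hk.2.1, hk.2.2.1, fun d hd => ?_⟩, fun d hd => ?_⟩
    · by_cases hde : d = e
      · simp [hde]
      · simpa [Function.update_of_ne hde] using hk.2.2.2 d hd
    · by_cases hde : d = e
      · simp [hde]
      · simpa [Function.update_of_ne hde] using hl d (by simpa [hde] using hd)

/-- Any set of edges compatible with a subsumption can be added by refinement. -/
theorem exists_reach_edges_subset {T : L} (hT : ∀ a, T ≤ a) {g k : DLG L} {m : ℕ → ℕ}
    (hm : SubsPOWith g k m) (S : Finset (ℕ × ℕ))
    (hS : ∀ e ∈ S, e.1 ∈ g.V ∧ e.2 ∈ g.V ∧ (m e.1, m e.2) ∈ k.E) :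
    ∃ h, Reach T g h ∧ h.V = g.V ∧ SubsPOWith h k m ∧ S ⊆ h.E := by
  induction S using Finset.induction_on with
  | empty => exact ⟨g, .refl, rfl, hm, by simp⟩
  | insert e S _ ih =>
    obtain ⟨h, hr, hV, hk, hSE⟩ := ih fun d hd => hS d (Finset.mem_insert_of_mem hd)
    by_cases he : e ∈ h.E
    · exact ⟨h, hr, hV, hk, Finset.insert_subset he hSE⟩
    obtain ⟨he₁, he₂, heE⟩ := hS e (Finset.mem_insert_self _ _)
    rw [← hV] at he₁ he₂
    let h' : DLG L :=
      { V := h.V, E := insert e h.E, lv := h.lv, le := Function.update h.le e T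
        edge_mem := by
          intro d hd
          rcases Finset.mem_insert.1 hd with rfl | hd
          exacts [⟨he₁, he₂⟩, h.edge_mem d hd] }
    refine ⟨h', hr.tail (Or.inr <| Or.inr <| Or.inr <| Or.inl
      ⟨e.1, he₁, e.2, he₂, he, rfl, rfl, rfl, rfl⟩), hV,
      ⟨hk.1, fun d hd => ?_, hk.2.2.1, fun d hd => ?_⟩, Finset.insert_subset_insert e hSE⟩
    · rcases Finset.mem_insert.1 hd with rfl | hd
      exacts [heE, hk.2.1 d hd]
    · by_cases hde : d = e
      · simp [h', hde, hT]
      · simpa [h', Function.update_of_ne hde] using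
          hk.2.2.2 d (Finset.mem_of_mem_insert_of_ne hd hde)

/-- A fresh vertex can be added by refinement so that the image of a subsumption grows by a
prescribed neighbour of a vertex in the image. -/
theorem exists_reach_image_insert {T : L} (hT : ∀ a, T ≤ a) {g k : DLG L} {m : ℕ → ℕ}
    (hm : SubsPOWith g k m) {v w : ℕ} (hv : v ∈ g.V) (hvw : k.adj (m v) w) :
    ∃ h m', Reach T g h ∧ SubsPOWith h k m' ∧ h.V.image m' = insert w (g.V.image m) := by
  have hw : w ∈ k.V := hvw.elim (fun h => (k.edge_mem _ h).2) fun h => (k.edge_mem _ h).1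
  have hne {u} (hu : u ∈ g.V) : u ≠ g.fresh := fun h => g.fresh_notMem (h ▸ hu)
  let m' := Function.update m g.fresh w
  have hm' {u} (hu : u ∈ g.V) : m' u = m u := Function.update_of_ne (hne hu) _ _
  have hmf : m' g.fresh = w := Function.update_self ..
  have key (e : ℕ × ℕ) (he₁ : e.1 ∈ insert g.fresh g.V) (he₂ : e.2 ∈ insert g.fresh g.V)
      (heE : (m' e.1, m' e.2) ∈ k.E)
      (hr : ∀ h : DLG L, h.V = insert g.fresh g.V → h.E = insert e g.E →
        h.lv = Function.update g.lv g.fresh T → h.le = Function.update g.le e T →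
        h ∈ rhoPO T g) :
      ∃ h m', Reach T g h ∧ SubsPOWith h k m' ∧ h.V.image m' = insert w (g.V.image m) := by
    let h : DLG L :=
      { V := insert g.fresh g.V, E := insert e g.E, lv := Function.update g.lv g.fresh T
        le := Function.update g.le e T
        edge_mem := by
          intro d hd
          rcases Finset.mem_insert.1 hd with rfl | hd
          · exact ⟨he₁, he₂⟩
          · exact ⟨Finset.mem_insert_of_mem (g.edge_mem d hd).1,
              Finset.mem_insert_of_mem (g.edge_mem d hd).2⟩ }
    refine ⟨h, m', .single (hr h rfl rfl rfl rfl), ⟨fun u hu => ?_, fun d hd => ?_,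
      fun u hu => ?_, fun d hd => ?_⟩, ?_⟩
    · rcases Finset.mem_insert.1 hu with rfl | hu
      · rwa [hmf]
      · rw [hm' hu]
        exact hm.1 u hu
    · rcases Finset.mem_insert.1 hd with rfl | hd
      · exact heE
      · rw [hm' (g.edge_mem d hd).1, hm' (g.edge_mem d hd).2]
        exact hm.2.1 d hd
    · rcases Finset.mem_insert.1 hu with rfl | hu
      · simp [h, hT]
      · simpa [h, hm' hu, hne hu] using hm.2.2.1 u hu
    · by_cases hde : d = e
      · simp [h, hde, hT]
      · have hd := Finset.mem_of_mem_insert_of_ne hd hde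
        rw [hm' (g.edge_mem d hd).1, hm' (g.edge_mem d hd).2]
        simpa [h, Function.update_of_ne hde] using hm.2.2.2 d hd
    · rw [Finset.image_insert, hmf, Finset.image_congr fun u hu => hm' hu]
  have hf := Finset.mem_insert_self g.fresh g.V
  have hv' := Finset.mem_insert_of_mem (b := g.fresh) hv
  rcases hvw with hE | hE
  · exact key (v, g.fresh) hv' hf (by simpa [hm' hv, hmf] using hE)
      fun h hV hE hlv hle => Or.inr <| Or.inl ⟨v, hv, hV, hE, hlv, hle⟩
  · exact key (g.fresh, v) hf hv' (by simpa [hm' hv, hmf] using hE)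
      fun h hV hE hlv hle => Or.inr <| Or.inr <| Or.inl ⟨v, hv, hV, hE, hlv, hle⟩

/-- A subsumption from a nonempty graph into a connected graph can be refined until it is
surjective on vertices. -/
theorem exists_reach_surjOn {T : L} (hT : ∀ a, T ≤ a) {g k : DLG L} {m : ℕ → ℕ}
    (hk : k.Connected) (hm : SubsPOWith g k m) (hg : g.V.Nonempty) :
    ∃ h m', Reach T g h ∧ SubsPOWith h k m' ∧ k.V ⊆ h.V.image m' := by
  induction hn : (k.V \ g.V.image m).card using Nat.strong_induction_on generalizing g m with
  | _ n ih =>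
    by_cases hsub : k.V ⊆ g.V.image m
    · exact ⟨g, m, .refl, hm, hsub⟩
    obtain ⟨b, hb, hbm⟩ := Finset.not_subset.1 hsub
    obtain ⟨a, ha⟩ := hg
    obtain ⟨x, hx, w, hw, hadj⟩ := exists_adj_of_reflTransGen (s := ↑(g.V.image m))
      (hk (m a) (hm.1 a ha) b hb) (Finset.mem_image_of_mem m ha) hbm
    obtain ⟨v, hv, rfl⟩ := Finset.mem_image.1 hx
    have hwk : w ∈ k.V := hadj.elim (fun h => (k.edge_mem _ h).2) fun h => (k.edge_mem _ h).1
    obtain ⟨h, m', hr, hm', him⟩ := exists_reach_image_insert hT hm hv hadj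
    have hne : h.V.Nonempty := Finset.image_nonempty.1 (him ▸ Finset.insert_nonempty _ _)
    obtain ⟨h', m'', hr', hm'', hs⟩ := ih _ (by
      rw [← hn, him]
      refine Finset.card_lt_card (Finset.ssubset_iff_of_subset
        (Finset.sdiff_subset_sdiff subset_rfl (Finset.subset_insert _ _)) |>.2
        ⟨w, Finset.mem_sdiff.2 ⟨hwk, hw⟩, by simp⟩)) hm' hne rfl
    exact ⟨h', m'', hr.trans hr', hm'', hs⟩

/-- A nonempty graph subsuming a connected graph `k` refines to a graph equivalent to `k`,
namely the pullback of `k` along a map surjective on vertices. -/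
theorem exists_reach_equiv_of_nonempty [Finite L] {T : L} (hT : ∀ a, T ≤ a) {g k : DLG L}
    (hk : k.Connected) (hgk : SubsPO g k) (hg : g.V.Nonempty) :
    ∃ h, Reach T g h ∧ SubsPO h k ∧ SubsPO k h := by
  obtain ⟨m₀, hm₀⟩ := hgk
  obtain ⟨g₁, m, hr₁, hm₁, hsurj⟩ := exists_reach_surjOn hT hk hm₀ hg
  obtain ⟨g₂, hr₂, hV₂, hm₂, hE₂⟩ := exists_reach_edges_subset hT hm₁
    ((g₁.V ×ˢ g₁.V).filter fun e => (m e.1, m e.2) ∈ k.E) (fun e he => by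
      simpa [and_assoc] using he)
  obtain ⟨g₃, hr₃, hV₃, hE₃, hm₃, hl₃⟩ := exists_reach_lv_eq T hm₂ g₂.V subset_rfl
  obtain ⟨g₄, hr₄, hV₄, hE₄, hlv₄, hm₄, hl₄⟩ := exists_reach_le_eq T hm₃ g₃.E subset_rfl
  refine ⟨g₄, ((hr₁.trans hr₂).trans hr₃).trans hr₄, ⟨m, hm₄⟩, ?_⟩
  have hs (v : ℕ) : ∃ u, v ∈ k.V → u ∈ g₁.V ∧ m u = v := by
    by_cases hv : v ∈ k.V
    · obtain ⟨u, hu⟩ := Finset.mem_image.1 (hsurj hv)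
      exact ⟨u, fun _ => hu⟩
    · exact ⟨0, fun h => absurd h hv⟩
  choose s hs using hs
  have hsE (e : ℕ × ℕ) (he : e ∈ k.E) : (s e.1, s e.2) ∈ g₂.E := by
    obtain ⟨h₁, e₁⟩ := hs _ (k.edge_mem e he).1
    obtain ⟨h₂, e₂⟩ := hs _ (k.edge_mem e he).2
    exact hE₂ (by simp [h₁, h₂, e₁, e₂, he])
  refine ⟨s, fun v hv => ?_, fun e he => ?_, fun v hv => ?_, fun e he => ?_⟩
  · rw [hV₄, hV₃, hV₂]
    exact (hs v hv).1
  · rw [hE₄, hE₃]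
    exact hsE e he
  · rw [hlv₄, hl₃ _ (hV₂ ▸ (hs v hv).1), (hs v hv).2]
  · rw [hl₄ _ (hE₃ ▸ hsE e he), (hs _ (k.edge_mem e he).1).2, (hs _ (k.edge_mem e he).2).2]

/-- An empty graph refines to a single vertex labeled `⊤`, which subsumes every nonempty graph. -/
theorem exists_reach_nonempty_of_empty {T : L} (hT : ∀ a, T ≤ a) {g k : DLG L} (hg : g.V = ∅)
    (hk : k.V.Nonempty) : ∃ h, Reach T g h ∧ h.V.Nonempty ∧ SubsPO h k := by
  obtain ⟨v, hv⟩ := hk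
  have hE : g.E = ∅ := Finset.eq_empty_of_forall_notMem fun e he => by
    simpa [hg] using (g.edge_mem e he).1
  exact ⟨⟨{g.fresh}, ∅, Function.update g.lv g.fresh T, g.le, by simp⟩,
    .single (Or.inl ⟨hg, hE, rfl, rfl, rfl, rfl⟩), by simp,
    fun _ => v, by simp [hv], by simp, by simp [hT], by simp⟩

end Refinement

end DLG

theorem rhoPO_locally_finite_and_complete {L : Type} [Fintype L] [PartialOrder L] (T : L) (hT : ∀ a : L, T ≤ a) :
    -- locally finite
    (∀ g : DLG L, g.Connected → (DLG.rhoPO T g).Finite) ∧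
    -- complete: if g₁ strictly subsumes g₂, a finite chain of refinements starting
    -- at g₁ reaches a graph equivalent to g₂
    (∀ g₁ g₂ : DLG L, g₁.Connected → g₂.Connected →
      DLG.SubsPO g₁ g₂ → ¬ DLG.SubsPO g₂ g₁ →
      ∃ h : DLG L, Relation.ReflTransGen (fun x y => y ∈ DLG.rhoPO T x) g₁ h ∧
        DLG.SubsPO h g₂ ∧ DLG.SubsPO g₂ h) := by
  refine ⟨fun g _ => DLG.rhoPO_finite T g, fun g₁ g₂ _ hc h₁₂ h₂₁ => ?_⟩
  rcases g₁.V.eq_empty_or_nonempty with hg | hg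
  · have hk : g₂.V.Nonempty := Finset.nonempty_iff_ne_empty.2 fun hk => h₂₁
      ⟨id, by simp [hk], fun e he => by simpa [hk] using (g₂.edge_mem e he).1, by simp [hk],
        fun e he => by simpa [hk] using (g₂.edge_mem e he).1⟩
    obtain ⟨g, hr, hne, hs⟩ := DLG.exists_reach_nonempty_of_empty hT hg hk
    obtain ⟨h, hr', hh⟩ := DLG.exists_reach_equiv_of_nonempty hT hc hs hne
    exact ⟨h, hr.trans hr', hh⟩
  · exact DLG.exists_reach_equiv_of_nonempty hT hc h₁₂ hg
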